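/- Let A be an input for the team power game with n teams and m time slots and let a_max := max_{i,j} A i j be the maximum true availability. If a_max ≥ 1 and there exist a time slot j* and a team i* such that A i* j* = a_max and A i j* = 0 for every team i ≠ i* (i.e., column j* has exactly one nonzero entry, and that entry equals a_max), then A admits a 1-strong Nash equilibrium. -/

import Mathlib

open Finset

section TPG

variable {T C : Type*} [Fintype T] [Fintype C] [DecidableEq T] [DecidableEq C]

/-- Sum of declared availabilities at a time slot. -/
def colSum (B : T → C → ℕ) (j : C) : ℕ := ∑ i, B i j

/-- Winning time slots: those maximizing the column sum. -/
def winners (B : T → C → ℕ) : Finset C :=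
  Finset.univ.filter fun j => ∀ j', colSum B j' ≤ colSum B j

/-- Relative power of team `i` at slot `j` (0 when the denominator is 0). -/
def power (B : T → C → ℕ) (i : T) (j : C) : ℚ :=
  (B i j : ℚ) / (colSum B j : ℚ)

/-- Pay-off of team `i`: minimum relative power over all winning slots. -/
def payoff (B : T → C → ℕ) (i : T) : ℚ :=
  if h : (winners B).Nonempty then (winners B).inf' h (power B i) else 0

/-- `B` is a strategy profile for input `A`. -/
def IsProfile (A B : T → C → ℕ) : Prop := ∀ i j, B i j ≤ A i j

/-- `D` is an improvement step for coalition `S` with respect to `B` (for input `A`). -/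
def IsImprovement (A B : T → C → ℕ) (S : Finset T) (D : T → C → ℕ) : Prop :=
  IsProfile A D ∧ (∀ i ∉ S, ∀ j, D i j = B i j) ∧ ∀ i ∈ S, payoff B i < payoff D i

/-- `B` is a `t`-strong Nash equilibrium for `A`. -/
def IsStrongNash (t : ℕ) (A B : T → C → ℕ) : Prop :=
  IsProfile A B ∧
    ∀ S : Finset T, S.Nonempty → S.card ≤ t → ∀ D, ¬ IsImprovement A B S D

end TPG

theorem payoff_le_power {T C : Type*} [Fintype T] [Fintype C] {B : T → C → ℕ} (i : T) {j : C}
    (hj : j ∈ winners B) : payoff B i ≤ power B i j := by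
  have hne : (winners B).Nonempty := ⟨j, hj⟩
  rw [payoff, dif_pos hne]
  exact Finset.inf'_le _ hj

theorem power_nonneg {T C : Type*} [Fintype T] (B : T → C → ℕ) (i : T) (j : C) :
    0 ≤ power B i j := by
  unfold power
  positivity

theorem power_le_one {T C : Type*} [Fintype T] (B : T → C → ℕ) (i : T) (j : C) :
    power B i j ≤ 1 := by
  refine div_le_one_of_le₀ ?_ (Nat.cast_nonneg _)
  exact_mod_cast Finset.single_le_sum (f := fun i => B i j) (fun _ _ => Nat.zero_le _)
    (Finset.mem_univ i)

theorem payoff_nonneg {T C : Type*} [Fintype T] [Fintype C] (B : T → C → ℕ) (i : T) :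
    0 ≤ payoff B i := by
  unfold payoff
  split_ifs with h
  · exact Finset.le_inf' _ _ fun j _ => power_nonneg B i j
  · exact le_rfl

theorem payoff_le_one {T C : Type*} [Fintype T] [Fintype C] (B : T → C → ℕ) (i : T) :
    payoff B i ≤ 1 := by
  by_cases h : (winners B).Nonempty
  · exact (payoff_le_power i h.choose_spec).trans (power_le_one B i _)
  · rw [payoff, dif_neg h]
    exact zero_le_one

/-- The profile in which only team `i₀` declares anything, namely `a` at the slot `j₀`. -/
def soloProfile {T C : Type*} [DecidableEq T] [DecidableEq C] (i₀ : T) (j₀ : C) (a : ℕ) :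
    T → C → ℕ :=
  fun i j => if i = i₀ ∧ j = j₀ then a else 0

theorem colSum_soloProfile {T C : Type*} [Fintype T] [DecidableEq T] [DecidableEq C]
    (i₀ : T) (j₀ : C) (a : ℕ) (j : C) :
    colSum (soloProfile i₀ j₀ a) j = if j = j₀ then a else 0 := by
  by_cases h : j = j₀ <;> simp [colSum, soloProfile, h]

theorem payoff_soloProfile {T C : Type*} [Fintype T] [Fintype C] [DecidableEq T] [DecidableEq C]
    (i₀ : T) (j₀ : C) {a : ℕ} (ha : 1 ≤ a) : payoff (soloProfile i₀ j₀ a) i₀ = 1 := by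
  have hw : winners (soloProfile i₀ j₀ a) = {j₀} := by
    ext j
    simp only [winners, Finset.mem_filter, Finset.mem_univ, true_and, colSum_soloProfile,
      Finset.mem_singleton]
    refine ⟨fun h => ?_, fun h j' => ?_⟩
    · by_contra hj
      have := h j₀
      simp only [if_true, if_neg hj] at this
      omega
    · rw [if_pos h]
      split_ifs <;> omega
  have ha' : (a : ℚ) ≠ 0 := by exact_mod_cast (by omega : a ≠ 0)
  simp [payoff, hw, power, colSum_soloProfile, soloProfile, ha']

/-- If some column `j*` has exactly one nonzero entry, which equals the maximum true
availability `a_max ≥ 1`, then a 1-strong Nash equilibrium exists. -/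
theorem one_strong_nash_of_lonely_max_column {n m : ℕ} (A : Fin n → Fin m → ℕ)
    (jstar : Fin m) (istar : Fin n)
    (hamax : 1 ≤ Finset.univ.sup fun i : Fin n => Finset.univ.sup fun j : Fin m => A i j)
    (hval : A istar jstar
      = Finset.univ.sup fun i : Fin n => Finset.univ.sup fun j : Fin m => A i j)
    (hzero : ∀ i, i ≠ istar → A i jstar = 0) :
    ∃ B : Fin n → Fin m → ℕ, IsStrongNash 1 A B := by
  have hle : ∀ i j, A i j ≤ A istar jstar := fun i j => by
    rw [hval]
    exact (Finset.le_sup (f := fun j => A i j) (Finset.mem_univ j)).trans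
      (Finset.le_sup (f := fun i => Finset.univ.sup fun j => A i j) (Finset.mem_univ i))
  rw [← hval] at hamax
  refine ⟨soloProfile istar jstar (A istar jstar), fun i j => ?_, ?_⟩
  · unfold soloProfile
    split_ifs with h
    · rw [h.1, h.2]
    · exact Nat.zero_le _
  rintro S hS hcard D ⟨hD, hout, himp⟩
  obtain ⟨i, rfl⟩ := Finset.card_eq_one.1 (le_antisymm hcard hS.card_pos)
  have hlt := himp i (Finset.mem_singleton_self i)
  by_cases hi : i = istar
  · subst hi
    rw [payoff_soloProfile i jstar hamax] at hlt
    exact absurd (payoff_le_one D i) hlt.not_ge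
  have hother : ∀ i', i' ≠ i → ∀ j, D i' j = soloProfile istar jstar (A istar jstar) i' j :=
    fun i' h j => hout i' (by simpa using h) j
  have hstar : A istar jstar ≤ colSum D jstar := by
    have h := Finset.single_le_sum (f := fun i => D i jstar) (fun _ _ => Nat.zero_le _)
      (Finset.mem_univ istar)
    simpa [hother istar (Ne.symm hi), soloProfile, colSum] using h
  have hwin : jstar ∈ winners D := by
    simp only [winners, Finset.mem_filter, Finset.mem_univ, true_and]
    intro j
    by_cases hj : j = jstar
    · rw [hj]
    have hsum : colSum D j = D i j :=
      Finset.sum_eq_single i (fun i' _ h => by simp [hother i' h, soloProfile, hj]) (by simp)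
    rw [hsum]
    exact (hD i j).trans ((hle i j).trans hstar)
  have hpow : power D i jstar = 0 := by
    have h : D i jstar = 0 := Nat.le_zero.1 (hzero i hi ▸ hD i jstar)
    simp [power, h]
  have h := payoff_le_power i hwin
  rw [hpow] at h
  exact absurd (h.trans (payoff_nonneg _ i)) hlt.not_ge
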